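/- Algebraic completeness for Int2GC+FS: a formula A is provable in Int2GC+FS if and only if v(A) = ⊤ for every valuation v on every H2GC+FS-algebra. -/

import Mathlib

/-- Formulas of the modal language with four unary modalities:
`dia1` = ◆, `box1` = □, `dia2` = ◇, `box2` = ■. -/
inductive Fm : Type
  | var : ℕ → Fm
  | and : Fm → Fm → Fm
  | or  : Fm → Fm → Fm
  | imp : Fm → Fm → Fm
  | neg : Fm → Fm
  | dia1 : Fm → Fm
  | box1 : Fm → Fm
  | dia2 : Fm → Fm
  | box2 : Fm → Fm

/-- Instances of the axiom schemes of intuitionistic propositional logic. -/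
inductive IntAx : Fm → Prop
  | a1 (A B : Fm) : IntAx (.imp A (.imp B A))
  | a2 (A B C : Fm) : IntAx (.imp (.imp A (.imp B C)) (.imp (.imp A B) (.imp A C)))
  | a3 (A B : Fm) : IntAx (.imp (.and A B) A)
  | a4 (A B : Fm) : IntAx (.imp (.and A B) B)
  | a5 (A B : Fm) : IntAx (.imp A (.imp B (.and A B)))
  | a6 (A B : Fm) : IntAx (.imp A (.or A B))
  | a7 (A B : Fm) : IntAx (.imp B (.or A B))
  | a8 (A B C : Fm) : IntAx (.imp (.imp A C) (.imp (.imp B C) (.imp (.or A B) C)))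
  | a9 (A B : Fm) : IntAx (.imp (.imp A B) (.imp (.imp A (.neg B)) (.neg A)))
  | a10 (A B : Fm) : IntAx (.imp (.neg A) (.imp A B))

/-- Provability in the extension of Int2GC by the extra axiom scheme `Ax`:
the smallest set of formulas containing all intuitionistic axiom instances and all
instances of `Ax`, closed under modus ponens and the four Galois-connection rules. -/
inductive Prov (Ax : Fm → Prop) : Fm → Prop
  | intAx {A : Fm} : IntAx A → Prov Ax A
  | extra {A : Fm} : Ax A → Prov Ax A
  | mp {A B : Fm} : Prov Ax (.imp A B) → Prov Ax A → Prov Ax B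
  | gc1 {A B : Fm} : Prov Ax (.imp A (.box1 B)) → Prov Ax (.imp (.dia1 A) B)
  | gc2 {A B : Fm} : Prov Ax (.imp (.dia1 A) B) → Prov Ax (.imp A (.box1 B))
  | gc3 {A B : Fm} : Prov Ax (.imp A (.box2 B)) → Prov Ax (.imp (.dia2 A) B)
  | gc4 {A B : Fm} : Prov Ax (.imp (.dia2 A) B) → Prov Ax (.imp A (.box2 B))

/-- The empty extra axiom scheme: `Prov NoAx` is provability in Int2GC itself. -/
def NoAx : Fm → Prop := fun _ => False

/-- Instances of (FS1): ◆(A → B) → (■A → ◆B). -/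
def FS1Ax (C : Fm) : Prop := ∃ A B : Fm, C = .imp (.dia1 (.imp A B)) (.imp (.box2 A) (.dia1 B))
/-- Instances of (FS2): ◇(A → B) → (□A → ◇B). -/
def FS2Ax (C : Fm) : Prop := ∃ A B : Fm, C = .imp (.dia2 (.imp A B)) (.imp (.box1 A) (.dia2 B))
/-- Instances of (FS3): (◆A → ■B) → ■(A → B). -/
def FS3Ax (C : Fm) : Prop := ∃ A B : Fm, C = .imp (.imp (.dia1 A) (.box2 B)) (.box2 (.imp A B))
/-- Instances of (FS4): (◇A → □B) → □(A → B). -/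
def FS4Ax (C : Fm) : Prop := ∃ A B : Fm, C = .imp (.imp (.dia2 A) (.box1 B)) (.box1 (.imp A B))
/-- The Fischer Servi scheme (FS1)+(FS2); `Prov FSAx` is provability in Int2GC+FS. -/
def FSAx (C : Fm) : Prop := FS1Ax C ∨ FS2Ax C

/-- The extension of a valuation `v` of the propositional variables to all formulas,
over a Heyting algebra equipped with four unary maps interpreting ◆, □, ◇, ■. -/
def Fm.val {H : Type*} [HeytingAlgebra H] (f g f' g' : H → H) (v : ℕ → H) : Fm → H
  | .var n => v n
  | .and A B => A.val f g f' g' v ⊓ B.val f g f' g' v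
  | .or A B => A.val f g f' g' v ⊔ B.val f g f' g' v
  | .imp A B => A.val f g f' g' v ⇨ B.val f g f' g' v
  | .neg A => A.val f g f' g' v ⇨ ⊥
  | .dia1 A => f (A.val f g f' g' v)
  | .box1 A => g (A.val f g f' g' v)
  | .dia2 A => f' (A.val f g f' g' v)
  | .box2 A => g' (A.val f g f' g' v)

namespace Prov

variable {Ax : Fm → Prop} {A B C D : Fm}

theorem weaken (A : Fm) (h : Prov Ax B) : Prov Ax (.imp A B) :=
  mp (intAx (.a1 B A)) h

theorem imp_mp (h : Prov Ax (.imp C (.imp A B))) (h' : Prov Ax (.imp C A)) :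
    Prov Ax (.imp C B) :=
  mp (mp (intAx (.a2 C A B)) h) h'

theorem imp_refl (A : Fm) : Prov Ax (.imp A A) :=
  imp_mp (intAx (.a1 A (.imp A A))) (intAx (.a1 A A))

theorem imp_trans (h : Prov Ax (.imp A B)) (h' : Prov Ax (.imp B C)) : Prov Ax (.imp A C) :=
  imp_mp (weaken A h') h

theorem and_left (A B : Fm) : Prov Ax (.imp (.and A B) A) := intAx (.a3 A B)

theorem and_right (A B : Fm) : Prov Ax (.imp (.and A B) B) := intAx (.a4 A B)

theorem or_inl (A B : Fm) : Prov Ax (.imp A (.or A B)) := intAx (.a6 A B)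

theorem or_inr (A B : Fm) : Prov Ax (.imp B (.or A B)) := intAx (.a7 A B)

theorem imp_and (h : Prov Ax (.imp C A)) (h' : Prov Ax (.imp C B)) :
    Prov Ax (.imp C (.and A B)) :=
  imp_mp (imp_trans h (intAx (.a5 A B))) h'

theorem or_imp (h : Prov Ax (.imp A C)) (h' : Prov Ax (.imp B C)) :
    Prov Ax (.imp (.or A B) C) :=
  mp (mp (intAx (.a8 A B C)) h) h'

theorem curry (h : Prov Ax (.imp (.and A B) C)) : Prov Ax (.imp A (.imp B C)) :=
  imp_trans (intAx (.a5 A B)) (mp (intAx (.a2 B (.and A B) C)) (weaken B h))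

theorem uncurry (h : Prov Ax (.imp A (.imp B C))) : Prov Ax (.imp (.and A B) C) :=
  imp_mp (imp_trans (and_left A B) h) (and_right A B)

theorem neg_imp_of_prov (B : Fm) (h : Prov Ax A) : Prov Ax (.imp (.neg A) B) :=
  imp_mp (intAx (.a10 A B)) (weaken _ h)

theorem imp_neg_imp_neg (A : Fm) (h : Prov Ax B) :
    Prov Ax (.imp (.imp A (.neg B)) (.neg A)) :=
  mp (intAx (.a9 A B)) (weaken A h)

theorem and_mono (h : Prov Ax (.imp A B)) (h' : Prov Ax (.imp C D)) :
    Prov Ax (.imp (.and A C) (.and B D)) :=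
  imp_and (imp_trans (and_left A C) h) (imp_trans (and_right A C) h')

theorem or_mono (h : Prov Ax (.imp A B)) (h' : Prov Ax (.imp C D)) :
    Prov Ax (.imp (.or A C) (.or B D)) :=
  or_imp (imp_trans h (or_inl B D)) (imp_trans h' (or_inr B D))

theorem imp_mono (h : Prov Ax (.imp B A)) (h' : Prov Ax (.imp C D)) :
    Prov Ax (.imp (.imp A C) (.imp B D)) :=
  curry (imp_trans (imp_mp (and_left _ B) (imp_trans (and_right _ B) h)) h')

theorem neg_anti (h : Prov Ax (.imp A B)) : Prov Ax (.imp (.neg B) (.neg A)) :=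
  imp_trans (imp_trans (intAx (.a10 B _)) (imp_mono h (imp_refl (.neg (.imp A A)))))
    (imp_neg_imp_neg A (imp_refl A))

theorem dia1_mono (h : Prov Ax (.imp A B)) : Prov Ax (.imp (.dia1 A) (.dia1 B)) :=
  gc1 (imp_trans h (gc2 (imp_refl _)))

theorem box1_mono (h : Prov Ax (.imp A B)) : Prov Ax (.imp (.box1 A) (.box1 B)) :=
  gc2 (imp_trans (gc1 (imp_refl _)) h)

theorem dia2_mono (h : Prov Ax (.imp A B)) : Prov Ax (.imp (.dia2 A) (.dia2 B)) :=
  gc3 (imp_trans h (gc4 (imp_refl _)))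

theorem box2_mono (h : Prov Ax (.imp A B)) : Prov Ax (.imp (.box2 A) (.box2 B)) :=
  gc4 (imp_trans (gc3 (imp_refl _)) h)

/-- Two formulas are identified when they are provably equivalent. -/
def setoid (Ax : Fm → Prop) : Setoid Fm where
  r A B := Prov Ax (.imp A B) ∧ Prov Ax (.imp B A)
  iseqv :=
    ⟨fun A => ⟨imp_refl A, imp_refl A⟩, And.symm,
      fun h h' => ⟨imp_trans h.1 h'.1, imp_trans h'.2 h.2⟩⟩

/-- The Lindenbaum–Tarski algebra of the extension of Int2GC by `Ax`. -/
def Lindenbaum (Ax : Fm → Prop) : Type := Quotient (setoid Ax)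

namespace Lindenbaum

/-- The class of a formula in the Lindenbaum–Tarski algebra. -/
def mk (Ax : Fm → Prop) (A : Fm) : Lindenbaum Ax := Quotient.mk (setoid Ax) A

theorem ind {p : Lindenbaum Ax → Prop} (h : ∀ A, p (mk Ax A)) (a : Lindenbaum Ax) : p a :=
  Quotient.ind h a

instance : PartialOrder (Lindenbaum Ax) where
  le := Quotient.lift₂ (fun A B => Prov Ax (.imp A B)) fun _ _ _ _ h h' =>
    propext ⟨fun k => imp_trans h.2 (imp_trans k h'.1), fun k => imp_trans h.1 (imp_trans k h'.2)⟩
  le_refl := ind fun A => imp_refl A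
  le_trans := ind fun _ => ind fun _ => ind fun _ => imp_trans
  le_antisymm := ind fun _ => ind fun _ => fun h h' => Quotient.sound ⟨h, h'⟩

theorem mk_le_mk : mk Ax A ≤ mk Ax B ↔ Prov Ax (.imp A B) := Iff.rfl

instance : HeytingAlgebra (Lindenbaum Ax) where
  sup := Quotient.map₂ .or fun _ _ h _ _ h' => ⟨or_mono h.1 h'.1, or_mono h.2 h'.2⟩
  le_sup_left := ind fun A => ind fun B => or_inl A B
  le_sup_right := ind fun A => ind fun B => or_inr A B
  sup_le := ind fun _ => ind fun _ => ind fun _ => or_imp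
  inf := Quotient.map₂ .and fun _ _ h _ _ h' => ⟨and_mono h.1 h'.1, and_mono h.2 h'.2⟩
  inf_le_left := ind fun A => ind fun B => and_left A B
  inf_le_right := ind fun A => ind fun B => and_right A B
  le_inf := ind fun _ => ind fun _ => ind fun _ => imp_and
  top := mk Ax (.imp (.var 0) (.var 0))
  le_top := ind fun A => weaken A (imp_refl _)
  bot := mk Ax (.neg (.imp (.var 0) (.var 0)))
  bot_le := ind fun A => neg_imp_of_prov A (imp_refl _)
  himp := Quotient.map₂ .imp fun _ _ h _ _ h' => ⟨imp_mono h.2 h'.1, imp_mono h.1 h'.2⟩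
  le_himp_iff := ind fun _ => ind fun _ => ind fun _ => ⟨uncurry, curry⟩
  compl := Quotient.map .neg fun _ _ h => ⟨neg_anti h.2, neg_anti h.1⟩
  himp_bot := ind fun A => Quotient.sound ⟨imp_neg_imp_neg A (imp_refl _), intAx (.a10 A _)⟩

theorem mk_eq_top : mk Ax A = ⊤ ↔ Prov Ax A :=
  top_le_iff.symm.trans ⟨fun h => mp (mk_le_mk.1 h) (imp_refl _), fun h => weaken _ h⟩

/-- The interpretation of ◆ in the Lindenbaum–Tarski algebra. -/
def dia1 : Lindenbaum Ax → Lindenbaum Ax :=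
  Quotient.map .dia1 fun _ _ h => ⟨dia1_mono h.1, dia1_mono h.2⟩

/-- The interpretation of □ in the Lindenbaum–Tarski algebra. -/
def box1 : Lindenbaum Ax → Lindenbaum Ax :=
  Quotient.map .box1 fun _ _ h => ⟨box1_mono h.1, box1_mono h.2⟩

/-- The interpretation of ◇ in the Lindenbaum–Tarski algebra. -/
def dia2 : Lindenbaum Ax → Lindenbaum Ax :=
  Quotient.map .dia2 fun _ _ h => ⟨dia2_mono h.1, dia2_mono h.2⟩

/-- The interpretation of ■ in the Lindenbaum–Tarski algebra. -/
def box2 : Lindenbaum Ax → Lindenbaum Ax :=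
  Quotient.map .box2 fun _ _ h => ⟨box2_mono h.1, box2_mono h.2⟩

theorem dia1_le_iff_le_box1 : ∀ a b : Lindenbaum Ax, dia1 a ≤ b ↔ a ≤ box1 b :=
  ind fun _ => ind fun _ => ⟨gc2, gc1⟩

theorem dia2_le_iff_le_box2 : ∀ a b : Lindenbaum Ax, dia2 a ≤ b ↔ a ≤ box2 b :=
  ind fun _ => ind fun _ => ⟨gc4, gc3⟩

theorem dia1_himp_le : ∀ a b : Lindenbaum FSAx, dia1 (a ⇨ b) ≤ box2 a ⇨ dia1 b :=
  ind fun A => ind fun B => extra (.inl ⟨A, B, rfl⟩)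

theorem dia2_himp_le : ∀ a b : Lindenbaum FSAx, dia2 (a ⇨ b) ≤ box1 a ⇨ dia2 b :=
  ind fun A => ind fun B => extra (.inr ⟨A, B, rfl⟩)

theorem val_mk_var (A : Fm) :
    A.val dia1 box1 dia2 box2 (fun n => mk Ax (.var n)) = mk Ax A := by
  induction A with
  | var n => rfl
  | neg A ih => rw [Fm.val, ih, himp_bot]; rfl
  | and A B ihA ihB => rw [Fm.val, ihA, ihB]; rfl
  | or A B ihA ihB => rw [Fm.val, ihA, ihB]; rfl
  | imp A B ihA ihB => rw [Fm.val, ihA, ihB]; rfl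
  | dia1 A ih => rw [Fm.val, ih]; rfl
  | box1 A ih => rw [Fm.val, ih]; rfl
  | dia2 A ih => rw [Fm.val, ih]; rfl
  | box2 A ih => rw [Fm.val, ih]; rfl

end Lindenbaum

section Soundness

variable {H : Type*} [HeytingAlgebra H] {f g f' g' : H → H}

theorem _root_.IntAx.val_eq_top (h : IntAx A) (v : ℕ → H) : A.val f g f' g' v = ⊤ := by
  cases h with
  | a2 A B C =>
    simp only [Fm.val, himp_eq_top_iff, le_himp_iff]
    generalize A.val f g f' g' v = a, B.val f g f' g' v = b, C.val f g f' g' v = c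
    have hb : (a ⇨ b ⇨ c) ⊓ (a ⇨ b) ⊓ a ≤ b :=
      (inf_le_inf_right a inf_le_right).trans himp_inf_le
    have hbc : (a ⇨ b ⇨ c) ⊓ (a ⇨ b) ⊓ a ≤ b ⇨ c :=
      (inf_le_inf_right a inf_le_left).trans himp_inf_le
    exact (le_inf hbc hb).trans himp_inf_le
  | a8 A B C =>
    simp only [Fm.val, himp_eq_top_iff, le_himp_iff, ← sup_himp_distrib]
    exact himp_inf_le
  | a9 A B =>
    simp only [Fm.val, himp_eq_top_iff, le_himp_iff]
    generalize A.val f g f' g' v = a, B.val f g f' g' v = b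
    have hb : (a ⇨ b) ⊓ (a ⇨ b ⇨ ⊥) ⊓ a ≤ b :=
      (inf_le_inf_right a inf_le_left).trans himp_inf_le
    have hnb : (a ⇨ b) ⊓ (a ⇨ b ⇨ ⊥) ⊓ a ≤ b ⇨ ⊥ :=
      (inf_le_inf_right a inf_le_right).trans himp_inf_le
    exact (le_inf hnb hb).trans himp_inf_le
  | a10 A B =>
    simp only [Fm.val, himp_eq_top_iff, le_himp_iff]
    exact himp_inf_le.trans bot_le
  | _ => simp [Fm.val, le_himp_iff]

/-- Soundness of `Prov Ax` for algebras with two Galois connections validating `Ax`. -/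
theorem val_eq_top (hfg : ∀ a b : H, f a ≤ b ↔ a ≤ g b) (hfg' : ∀ a b : H, f' a ≤ b ↔ a ≤ g' b)
    (v : ℕ → H) (hAx : ∀ B, Ax B → B.val f g f' g' v = ⊤) (h : Prov Ax A) :
    A.val f g f' g' v = ⊤ := by
  induction h with
  | intAx h => exact h.val_eq_top v
  | extra h => exact hAx _ h
  | mp _ _ ih ih' => rwa [Fm.val, ih', top_himp] at ih
  | gc1 _ ih => exact himp_eq_top_iff.2 ((hfg _ _).2 (himp_eq_top_iff.1 ih))
  | gc2 _ ih => exact himp_eq_top_iff.2 ((hfg _ _).1 (himp_eq_top_iff.1 ih))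
  | gc3 _ ih => exact himp_eq_top_iff.2 ((hfg' _ _).2 (himp_eq_top_iff.1 ih))
  | gc4 _ ih => exact himp_eq_top_iff.2 ((hfg' _ _).1 (himp_eq_top_iff.1 ih))

end Soundness

end Prov

/-- Algebraic completeness for Int2GC+FS: a formula is provable in Int2GC+FS iff it is
valid (takes value ⊤ under every valuation) in every H2GC+FS-algebra. -/
theorem int2gcfs_algebraic_completeness (A : Fm) :
    Prov FSAx A ↔
      ∀ (H : Type) [HeytingAlgebra H] (f g f' g' : H → H),
        (∀ a b : H, f a ≤ b ↔ a ≤ g b) → (∀ a b : H, f' a ≤ b ↔ a ≤ g' b) →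
        (∀ a b : H, f (a ⇨ b) ≤ g' a ⇨ f b) → (∀ a b : H, f' (a ⇨ b) ≤ g a ⇨ f' b) →
        ∀ v : ℕ → H, A.val f g f' g' v = ⊤ := by
  constructor
  · intro h H _ f g f' g' hfg hfg' hfs hfs' v
    refine h.val_eq_top hfg hfg' v ?_
    rintro _ (⟨B, C, rfl⟩ | ⟨B, C, rfl⟩)
    · exact himp_eq_top_iff.2 (hfs _ _)
    · exact himp_eq_top_iff.2 (hfs' _ _)
  · intro h
    rw [← Prov.Lindenbaum.mk_eq_top, ← Prov.Lindenbaum.val_mk_var]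
    exact h _ _ _ _ _ Prov.Lindenbaum.dia1_le_iff_le_box1 Prov.Lindenbaum.dia2_le_iff_le_box2
      Prov.Lindenbaum.dia1_himp_le Prov.Lindenbaum.dia2_himp_le _
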